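/- For every l ∈ ℕ, the mixed derivative of P_l ∘ h along V^⊥ in the x-variables and V^⊥ in the y-variables, evaluated on the diagonal, satisfies V_x^⊥ V_y^⊥ P_l(h)|_{x=y} = ‖V^⊥‖²(θ, φ) P_l'(1), where ‖V^⊥‖²(θ, φ) = sin²(φ)(sin²(φ) v₁(θ, φ)² + v₂(θ, φ)²). -/

import Mathlib

open Real

/-- The degree-`l` Legendre polynomial, via the Rodrigues formula
`P_l(t) = 1/(2^l l!) dˡ/dtˡ (t² − 1)ˡ`. -/
noncomputable def legP (l : ℕ) : ℝ → ℝ :=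
  fun t => (1 / (2 ^ l * (Nat.factorial l : ℝ))) * iteratedDeriv l (fun s => (s ^ 2 - 1) ^ l) t

/-- `h(θ_x, φ_x, θ_y, φ_y)`, the cosine of the spherical distance. -/
noncomputable def sphH (θx φx θy φy : ℝ) : ℝ :=
  Real.cos φx * Real.cos φy + Real.sin φx * Real.sin φy * Real.cos (θx - θy)

/-- Functions of the four variables `(θ_x, φ_x, θ_y, φ_y)`. -/
abbrev F4 : Type := ℝ → ℝ → ℝ → ℝ → ℝ

/-- `∂/∂θ_x`. -/
noncomputable def pθx (f : F4) : F4 := fun a b c d => deriv (fun t => f t b c d) a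
/-- `∂/∂φ_x`. -/
noncomputable def pφx (f : F4) : F4 := fun a b c d => deriv (fun t => f a t c d) b
/-- `∂/∂θ_y`. -/
noncomputable def pθy (f : F4) : F4 := fun a b c d => deriv (fun t => f a b t d) c
/-- `∂/∂φ_y`. -/
noncomputable def pφy (f : F4) : F4 := fun a b c d => deriv (fun t => f a b c t) d

/-- The operator `V_x = v₁(θ_x,φ_x) ∂/∂θ_x + v₂(θ_x,φ_x) ∂/∂φ_x`. -/
noncomputable def Vx (v₁ v₂ : ℝ → ℝ → ℝ) (f : F4) : F4 :=
  fun a b c d => v₁ a b * pθx f a b c d + v₂ a b * pφx f a b c d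

/-- The operator `V_y = v₁(θ_y,φ_y) ∂/∂θ_y + v₂(θ_y,φ_y) ∂/∂φ_y`. -/
noncomputable def Vy (v₁ v₂ : ℝ → ℝ → ℝ) (f : F4) : F4 :=
  fun a b c d => v₁ c d * pθy f a b c d + v₂ c d * pφy f a b c d

/-- The operator `V_x^⊥ = v₂(θ_x,φ_x) ∂/∂θ_x − sin²(φ_x) v₁(θ_x,φ_x) ∂/∂φ_x`. -/
noncomputable def Vxp (v₁ v₂ : ℝ → ℝ → ℝ) (f : F4) : F4 :=
  fun a b c d => v₂ a b * pθx f a b c d - (Real.sin b) ^ 2 * v₁ a b * pφx f a b c d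

/-- The operator `V_y^⊥ = v₂(θ_y,φ_y) ∂/∂θ_y − sin²(φ_y) v₁(θ_y,φ_y) ∂/∂φ_y`. -/
noncomputable def Vyp (v₁ v₂ : ℝ → ℝ → ℝ) (f : F4) : F4 :=
  fun a b c d => v₂ c d * pθy f a b c d - (Real.sin d) ^ 2 * v₁ c d * pφy f a b c d

/-- `P_l ∘ h` as a function of the four variables. -/
noncomputable def PH (l : ℕ) : F4 := fun a b c d => legP l (sphH a b c d)

theorem contDiff_legP (l : ℕ) : ContDiff ℝ 2 (legP l) := by
  have h : ContDiff ℝ (2 + l : ℕ) (fun s : ℝ => (s ^ 2 - 1) ^ l) := by fun_prop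
  unfold legP
  refine contDiff_const.mul ?_
  rw [iteratedDeriv_eq_iterate]
  exact ContDiff.iterate_deriv' 2 l h

theorem hasDerivAt_sphH_θx (a b c d : ℝ) :
    HasDerivAt (fun t => sphH t b c d) (-(sin b * sin d * sin (a - c))) a := by
  have h := ((((hasDerivAt_id a).sub_const c).cos).const_mul (sin b * sin d)).const_add
    (cos b * cos d)
  exact h.congr_deriv (by simp)

theorem hasDerivAt_sphH_φx (a b c d : ℝ) :
    HasDerivAt (fun t => sphH a t c d) (-(sin b * cos d) + cos b * sin d * cos (a - c)) b := by
  have h := ((hasDerivAt_cos b).mul_const (cos d)).add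
    (((hasDerivAt_sin b).mul_const (sin d)).mul_const (cos (a - c)))
  exact h.congr_deriv (by ring)

theorem sphH_comm (a b c d : ℝ) : sphH a b c d = sphH c d a b := by
  unfold sphH
  rw [← cos_neg (a - c), neg_sub]
  ring

theorem hasDerivAt_sphH_θy (a b c d : ℝ) :
    HasDerivAt (fun t => sphH a b t d) (sin b * sin d * sin (a - c)) c := by
  simp_rw [fun t => sphH_comm a b t d]
  refine (hasDerivAt_sphH_θx c d a b).congr_deriv ?_
  rw [← neg_sub a c, sin_neg]
  ring

theorem hasDerivAt_sphH_φy (a b c d : ℝ) :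
    HasDerivAt (fun t => sphH a b c t) (-(cos b * sin d) + sin b * cos d * cos (a - c)) d := by
  simp_rw [fun t => sphH_comm a b c t]
  refine (hasDerivAt_sphH_φx c d a b).congr_deriv ?_
  rw [← neg_sub a c, cos_neg]
  ring

theorem sphH_self (θ φ : ℝ) : sphH θ φ θ φ = 1 := by
  unfold sphH
  rw [sub_self, cos_zero]
  linarith [sin_sq_add_cos_sq φ]

/-- The function `V_y^⊥ h`. -/
noncomputable def vypSphH (v₁ v₂ : ℝ → ℝ → ℝ) : F4 := fun a b c d =>
  v₂ c d * (sin b * sin d * sin (a - c)) -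
    sin d ^ 2 * v₁ c d * (-(cos b * sin d) + sin b * cos d * cos (a - c))

theorem Vyp_PH (v₁ v₂ : ℝ → ℝ → ℝ) (l : ℕ) :
    Vyp v₁ v₂ (PH l) = fun a b c d =>
      deriv (legP l) (sphH a b c d) * vypSphH v₁ v₂ a b c d := by
  have hP : Differentiable ℝ (legP l) := (contDiff_legP l).differentiable (by norm_num)
  funext a b c d
  have hθ : pθy (PH l) a b c d = _ :=
    ((hP (sphH a b c d)).hasDerivAt.comp c (hasDerivAt_sphH_θy a b c d)).deriv
  have hφ : pφy (PH l) a b c d = _ :=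
    ((hP (sphH a b c d)).hasDerivAt.comp d (hasDerivAt_sphH_φy a b c d)).deriv
  unfold Vyp vypSphH
  rw [hθ, hφ]
  ring

theorem vypSphH_self (v₁ v₂ : ℝ → ℝ → ℝ) (θ φ : ℝ) : vypSphH v₁ v₂ θ φ θ φ = 0 := by
  unfold vypSphH
  rw [sub_self, cos_zero, sin_zero]
  ring

theorem hasDerivAt_vypSphH_θx (v₁ v₂ : ℝ → ℝ → ℝ) (θ φ : ℝ) :
    HasDerivAt (fun t => vypSphH v₁ v₂ t φ θ φ) (sin φ ^ 2 * v₂ θ φ) θ := by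
  have hs := ((hasDerivAt_id θ).sub_const θ).sin
  have hc := ((hasDerivAt_id θ).sub_const θ).cos
  have h := ((hs.const_mul (sin φ * sin φ)).const_mul (v₂ θ φ)).sub
    (((hc.const_mul (sin φ * cos φ)).const_add (-(cos φ * sin φ))).const_mul
      (sin φ ^ 2 * v₁ θ φ))
  refine h.congr_deriv ?_
  simp only [id, sub_self, cos_zero, sin_zero]
  ring

theorem hasDerivAt_vypSphH_φx (v₁ v₂ : ℝ → ℝ → ℝ) (θ φ : ℝ) :
    HasDerivAt (fun t => vypSphH v₁ v₂ θ t θ φ) (-(sin φ ^ 2 * v₁ θ φ)) φ := by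
  have hs := hasDerivAt_sin φ
  have hc := hasDerivAt_cos φ
  have h := (((hs.mul_const (sin φ)).mul_const (sin (θ - θ))).const_mul (v₂ θ φ)).sub
    (((hc.mul_const (sin φ)).neg.add ((hs.mul_const (cos φ)).mul_const (cos (θ - θ)))).const_mul
      (sin φ ^ 2 * v₁ θ φ))
  refine h.congr_deriv ?_
  simp only [sub_self, cos_zero, sin_zero]
  linear_combination -(sin φ ^ 2 * v₁ θ φ) * sin_sq_add_cos_sq φ

/-- `V_x^⊥ V_y^⊥ P_l(h)` on the diagonal equals `‖V^⊥‖² P_l'(1)`. -/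
theorem VxperpVyperp_on_diagonal
    (v₁ v₂ : ℝ → ℝ → ℝ)
    (hv₁ : ContDiff ℝ (⊤ : ℕ∞) (Function.uncurry v₁)) (hv₂ : ContDiff ℝ (⊤ : ℕ∞) (Function.uncurry v₂))
    (l : ℕ) (θ φ : ℝ) (hφ : φ ∈ Set.Ioo 0 π) :
    Vxp v₁ v₂ (Vyp v₁ v₂ (PH l)) θ φ θ φ =
      (Real.sin φ) ^ 2 * ((Real.sin φ) ^ 2 * (v₁ θ φ) ^ 2 + (v₂ θ φ) ^ 2) *
        deriv (legP l) 1 := by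
  have hP' : Differentiable ℝ (deriv (legP l)) :=
    (contDiff_legP l).differentiable_deriv_two
  have hdθ : pθx (Vyp v₁ v₂ (PH l)) θ φ θ φ = deriv (legP l) 1 * (sin φ ^ 2 * v₂ θ φ) := by
    rw [Vyp_PH]
    refine ((((hP' (sphH θ φ θ φ)).hasDerivAt.comp θ (hasDerivAt_sphH_θx θ φ θ φ)).mul
      (hasDerivAt_vypSphH_θx v₁ v₂ θ φ)).congr_deriv ?_).deriv
    simp [vypSphH_self, sphH_self]
  have hdφ : pφx (Vyp v₁ v₂ (PH l)) θ φ θ φ = deriv (legP l) 1 * -(sin φ ^ 2 * v₁ θ φ) := by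
    rw [Vyp_PH]
    refine ((((hP' (sphH θ φ θ φ)).hasDerivAt.comp (h := fun t => sphH θ t θ φ) φ
      (hasDerivAt_sphH_φx θ φ θ φ)).mul
      (hasDerivAt_vypSphH_φx v₁ v₂ θ φ)).congr_deriv ?_).deriv
    simp [vypSphH_self, sphH_self]
  unfold Vxp
  rw [hdθ, hdφ]
  ring
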